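/- Let X be a compact metric space, T : X → X a continuous map, m ≥ 1, and let U ⊆ X and V ⊆ H_{m,k} be compact subsets with dim U + dim V ≤ n, such that the sets U, TU, …, T^n U, V, TV, …, T^{m+k−1}V are pairwise disjoint, where 0 ≤ k ≤ m + k ≤ n, and T is injective on each of the sets U, …, T^{n−1}U, V, …, T^{k−1}V. Then the set Ω = { f ∈ C(X, ℝ) : f observes T on U × V in n steps } is open and dense in C(X, ℝ). -/

import Mathlib

open Set Topology Function

/-- `CovDimLE X d` : the topological (Lebesgue covering) dimension of `X` is at most `d`. -/
def CovDimLE (X : Type*) [TopologicalSpace X] (d : ℕ) : Prop :=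
  ∀ 𝒰 : Set (Set X), (∀ U ∈ 𝒰, IsOpen U) → ⋃₀ 𝒰 = Set.univ →
    ∃ 𝒱 : Set (Set X), (∀ V ∈ 𝒱, IsOpen V) ∧ ⋃₀ 𝒱 = Set.univ ∧
      (∀ V ∈ 𝒱, ∃ U ∈ 𝒰, V ⊆ U) ∧
      ∀ x : X, {V ∈ 𝒱 | x ∈ V}.Finite ∧ Nat.card {V ∈ 𝒱 | x ∈ V} ≤ d + 1

/-- `Hm T m` : points of (exact) period `m`. -/
def Hm {X : Type*} (T : X → X) (m : ℕ) : Set X :=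
  {x | T^[m] x = x ∧ ∀ i j : ℕ, i < m → j < m → i ≠ j → T^[i] x ≠ T^[j] x}

/-- `Hmk T m k` : preperiodic points of period `m`, reaching `Hm T m` exactly at step `k`
(with `H_{m,0} = H_m`). -/
def Hmk {X : Type*} (T : X → X) (m k : ℕ) : Set X :=
  if k = 0 then Hm T m
  else {x | T^[k] x ∈ Hm T m ∧ T^[k - 1] x ∉ Hm T m}

lemma exists_dist_lt_forall_notMem_affineSpan {E : Type*} [NormedAddCommGroup E]
    [NormedSpace ℝ E] [FiniteDimensional ℝ E] {α : Type*} [Finite α] (p : α → E) (x : E)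
    {ε : ℝ} (hε : 0 < ε) :
    ∃ q, dist q x < ε ∧ ∀ S : Finset α, S.card ≤ Module.finrank ℝ E →
      q ∉ affineSpan ℝ (p '' S) := by
  classical
  borelize E
  have hspan (S : Finset α) (hS : S.card ≤ Module.finrank ℝ E) :
      affineSpan ℝ (p '' S) ≠ ⊤ := by
    intro htop
    rcases Nat.eq_zero_or_pos S.card with h0 | h0
    · rw [Finset.card_eq_zero.1 h0] at htop
      simp at htop
    · have h1 := finrank_vectorSpan_image_finset_le ℝ p S (n := S.card - 1) (by omega)
      have h2 : vectorSpan ℝ (p '' (S : Set α)) = ⊤ := by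
        rw [← direction_affineSpan, htop, AffineSubspace.direction_top]
      rw [Finset.coe_image, h2, finrank_top] at h1
      omega
  have hae : ∀ᵐ q ∂(MeasureTheory.Measure.addHaar : MeasureTheory.Measure E),
      ∀ S : Finset α, S.card ≤ Module.finrank ℝ E → q ∉ affineSpan ℝ (p '' S) := by
    refine MeasureTheory.ae_all_iff.2 fun S ↦ ?_
    by_cases hS : S.card ≤ Module.finrank ℝ E
    · have h0 := MeasureTheory.Measure.addHaar_affineSubspace
        (MeasureTheory.Measure.addHaar : MeasureTheory.Measure E) _ (hspan S hS)
      filter_upwards [MeasureTheory.compl_mem_ae_iff.2 h0] with q hq _ using hq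
    · exact Filter.Eventually.of_forall fun q h ↦ absurd h hS
  obtain ⟨q, hq, hd⟩ := (MeasureTheory.Measure.dense_of_ae hae).exists_dist_lt x hε
  exact ⟨q, by rwa [dist_comm], hq⟩

lemma exists_perturbation_combination_ne_of_support_subset {E : Type*} [NormedAddCommGroup E]
    [NormedSpace ℝ E] [FiniteDimensional ℝ E] {ι κ : Type*} [Fintype ι] [Fintype κ]
    (c : ι → E) (p : κ → E) {ε : ℝ} (hε : 0 < ε) (s : Finset ι) :
    ∃ u : ι → E, (∀ i, dist (u i) (c i) < ε) ∧ ∀ (w : ι → ℝ) (z : κ → ℝ),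
      (∀ i ∉ s, w i = 0) → ∑ i, w i = 1 → ∑ j, z j = 1 →
      Nat.card {i // w i ≠ 0} + Nat.card {j // z j ≠ 0} ≤ Module.finrank ℝ E + 1 →
      ∑ i, w i • u i ≠ ∑ j, z j • p j := by
  classical
  induction s using Finset.induction_on with
  | empty =>
    refine ⟨c, fun i ↦ by simpa using hε, fun w z hw hw1 ↦ ?_⟩
    simp [hw] at hw1
  | insert a s ha ih =>
    obtain ⟨u, hu, hne⟩ := ih
    obtain ⟨q, hqd, hq⟩ := exists_dist_lt_forall_notMem_affineSpan (Sum.elim u p) (c a) hε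
    refine ⟨update u a q, fun i ↦ ?_, fun w z hw hw1 hz1 hcard heq ↦ ?_⟩
    · rcases eq_or_ne i a with rfl | hi
      · simpa using hqd
      · simpa [hi] using hu i
    have hsplit (v : ι → E) : ∑ i, w i • v i =
        w a • v a + ∑ i ∈ Finset.univ.erase a, w i • v i :=
      (Finset.add_sum_erase _ _ (Finset.mem_univ a)).symm
    have hrest : ∑ i ∈ Finset.univ.erase a, w i • update u a q i =
        ∑ i ∈ Finset.univ.erase a, w i • u i :=
      Finset.sum_congr rfl fun i hi ↦ by rw [update_of_ne (Finset.ne_of_mem_erase hi)]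
    rw [hsplit, hrest, update_self] at heq
    by_cases hwa : w a = 0
    · refine hne w z (fun i hi ↦ ?_) hw1 hz1 hcard ?_
      · rcases eq_or_ne i a with rfl | hia
        · exact hwa
        · exact hw i (by simp [hia, hi])
      · rw [hsplit, ← heq]
        simp [hwa]
    set W : ι ⊕ κ → ℝ :=
      Sum.elim (fun i ↦ if i = a then 0 else -(w a)⁻¹ * w i) (fun j ↦ (w a)⁻¹ * z j) with hW
    have hWsum : ∑ t, W t = 1 := by
      rw [Fintype.sum_sum_type]
      simp only [hW, Sum.elim_inl, Sum.elim_inr, ← Finset.mul_sum, hz1]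
      rw [← Finset.add_sum_erase _ _ (Finset.mem_univ a)] at hw1 ⊢
      rw [Finset.sum_congr rfl fun i hi ↦ if_neg (Finset.ne_of_mem_erase hi),
        ← Finset.mul_sum, eq_sub_of_add_eq' hw1, if_pos rfl]
      field_simp
      linarith
    have hWq : ∑ t, W t • Sum.elim u p t = q := by
      rw [Fintype.sum_sum_type]
      simp only [hW, Sum.elim_inl, Sum.elim_inr, mul_smul, ← Finset.smul_sum, ← heq]
      rw [← Finset.add_sum_erase _ _ (Finset.mem_univ a)]
      rw [Finset.sum_congr rfl fun i hi ↦ by rw [if_neg (Finset.ne_of_mem_erase hi), mul_smul],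
        ← Finset.smul_sum]
      simp [smul_smul, hwa]
    refine hq (Finset.univ.filter fun t ↦ W t ≠ 0) ?_ ?_
    · have hc : (Finset.univ.filter fun t ↦ W t ≠ 0).card =
          ((Finset.univ.filter fun i ↦ w i ≠ 0).erase a).card +
            (Finset.univ.filter fun j ↦ z j ≠ 0).card := by
        rw [Finset.card_filter, Fintype.sum_sum_type, ← Finset.card_filter,
          ← Finset.card_filter]
        congr 2
        · ext i
          simp [hW, hwa]
        · ext j
          simp [hW, hwa]
      rw [hc, Finset.card_erase_of_mem (by simpa using hwa)]
      rw [Nat.card_eq_fintype_card, Nat.card_eq_fintype_card, Fintype.card_subtype,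
        Fintype.card_subtype] at hcard
      have : 0 < (Finset.univ.filter fun i ↦ w i ≠ 0).card :=
        Finset.card_pos.2 ⟨a, by simpa using hwa⟩
      omega
    · rw [← hWq, ← Finset.affineCombination_eq_linear_combination _ _ _ hWsum]
      exact affineCombination_mem_affineSpan_image hWsum (by simp) _

lemma exists_perturbation_combination_ne {E : Type*} [NormedAddCommGroup E]
    [NormedSpace ℝ E] [FiniteDimensional ℝ E] {ι κ : Type*} [Fintype ι] [Fintype κ]
    (c : ι → E) (p : κ → E) {ε : ℝ} (hε : 0 < ε) :
    ∃ u : ι → E, (∀ i, dist (u i) (c i) < ε) ∧ ∀ (w : ι → ℝ) (z : κ → ℝ),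
      ∑ i, w i = 1 → ∑ j, z j = 1 →
      Nat.card {i // w i ≠ 0} + Nat.card {j // z j ≠ 0} ≤ Module.finrank ℝ E + 1 →
      ∑ i, w i • u i ≠ ∑ j, z j • p j := by
  obtain ⟨u, hu, h⟩ :=
    exists_perturbation_combination_ne_of_support_subset c p hε Finset.univ
  exact ⟨u, hu, fun w z ↦ h w z (by simp)⟩

/-- A continuous map on a compact Hausdorff space of dimension at most `d` admits a partition of
unity with at most `d + 1` functions nonzero at each point, on whose supports the map is nearly
constant. -/
lemma CovDimLE.exists_partitionOfUnity {K E : Type*} [TopologicalSpace K] [CompactSpace K]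
    [T2Space K] [PseudoMetricSpace E] {d : ℕ} (hK : CovDimLE K d) (g : C(K, E)) {ε : ℝ}
    (hε : 0 < ε) :
    ∃ (s : Finset (Set K)) (ψ : PartitionOfUnity s K) (c : s → E),
      (∀ x, Nat.card {i // ψ i x ≠ 0} ≤ d + 1) ∧
      ∀ x i, ψ i x ≠ 0 → dist (c i) (g x) < ε := by
  obtain ⟨𝒱, hVo, hVc, hVr, hVd⟩ := hK (range fun c ↦ g ⁻¹' Metric.ball c ε)
    (by rintro _ ⟨c, rfl⟩; exact Metric.isOpen_ball.preimage g.continuous)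
    (eq_univ_of_forall fun x ↦ ⟨_, ⟨g x, rfl⟩, by simpa using hε⟩)
  obtain ⟨t, htV, htf, ht⟩ := isCompact_univ.elim_finite_subcover_image (b := 𝒱) (c := id)
    hVo (by rw [← hVc, sUnion_eq_biUnion]; rfl)
  lift t to Finset (Set K) using htf
  obtain ⟨ψ, hψ⟩ := PartitionOfUnity.exists_isSubordinate isClosed_univ
    (fun i : t ↦ (i : Set K)) (fun i ↦ hVo _ (htV i.2)) (by simpa [iUnion_subtype] using ht)
  have hmem (x : K) (i : t) (h : ψ i x ≠ 0) : x ∈ (i : Set K) :=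
    hψ i (subset_tsupport _ h)
  have hball (i : t) : ∃ c, (i : Set K) ⊆ g ⁻¹' Metric.ball c ε := by
    obtain ⟨_, ⟨c, rfl⟩, hc⟩ := hVr i (htV i.2)
    exact ⟨c, hc⟩
  choose c hc using hball
  refine ⟨t, ψ, c, fun x ↦ ?_, fun x i h ↦ ?_⟩
  · have := (hVd x).1.to_subtype
    exact (Nat.card_le_card_of_injective (β := {V ∈ 𝒱 | x ∈ V})
      (fun i ↦ ⟨i.1.1, htV i.1.2, hmem x i.1 i.2⟩)
      fun i j hij ↦ Subtype.ext (Subtype.ext (congrArg (fun V ↦ V.1) hij))).trans (hVd x).2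
  · have := hc i (hmem x i h)
    rwa [mem_preimage, Metric.mem_ball, dist_comm] at this

lemma PartitionOfUnity.dist_sum_smul_le {ι K E : Type*} [Fintype ι] [TopologicalSpace K]
    [SeminormedAddCommGroup E] [NormedSpace ℝ E] (ψ : PartitionOfUnity ι K) (u : ι → E) (x : K)
    (y : E) {ε : ℝ} (h : ∀ i, ψ i x ≠ 0 → dist (u i) y ≤ ε) :
    dist (∑ i, ψ i x • u i) y ≤ ε := by
  rw [← finsum_eq_sum_of_fintype]
  exact (convex_closedBall y ε).finsum_mem (fun i ↦ ψ.nonneg i x) (ψ.sum_eq_one (mem_univ x)) h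

/-- Two continuous maps from compact Hausdorff spaces to finite-dimensional spaces can be perturbed
so that their images are disjoint when the dimensions of the spaces sum to less than that of the
target. -/
lemma exists_approx_forall_ne {K₁ K₂ E F : Type*} [TopologicalSpace K₁] [CompactSpace K₁]
    [T2Space K₁] [TopologicalSpace K₂] [CompactSpace K₂] [T2Space K₂] [NormedAddCommGroup E]
    [NormedSpace ℝ E] [FiniteDimensional ℝ E] [NormedAddCommGroup F] [NormedSpace ℝ F] {a b : ℕ}
    (ha : CovDimLE K₁ a) (hb : CovDimLE K₂ b) (hab : a + b < Module.finrank ℝ E)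
    (g : C(K₁, E)) (h : C(K₂, F)) (L : F →ₗ[ℝ] E) {ε : ℝ} (hε : 0 < ε) :
    ∃ (g' : C(K₁, E)) (h' : C(K₂, F)), (∀ x, dist (g' x) (g x) ≤ ε) ∧
      (∀ y, dist (h' y) (h y) ≤ ε) ∧ ∀ x y, g' x ≠ L (h' y) := by
  obtain ⟨s, ψ, c, hψ, hc⟩ := ha.exists_partitionOfUnity g (half_pos hε)
  obtain ⟨t, φ, v, hφ, hv⟩ := hb.exists_partitionOfUnity h hε
  obtain ⟨u, hu, hne⟩ :=
    exists_perturbation_combination_ne c (fun j ↦ L (v j)) (half_pos hε)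
  refine ⟨⟨fun x ↦ ∑ i, ψ i x • u i, by fun_prop⟩, ⟨fun y ↦ ∑ j, φ j y • v j, by fun_prop⟩,
    fun x ↦ ψ.dist_sum_smul_le _ _ _ fun i hi ↦ ?_,
    fun y ↦ φ.dist_sum_smul_le _ _ _ fun j hj ↦ (hv y j hj).le, fun x y ↦ ?_⟩
  · linarith [dist_triangle (u i) (c i) (g x), hu i, hc x i hi]
  · have hx := ψ.sum_eq_one (mem_univ x)
    have hy := φ.sum_eq_one (mem_univ y)
    rw [finsum_eq_sum_of_fintype] at hx hy
    simpa using hne (fun i ↦ ψ i x) (fun j ↦ φ j y) hx hy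
      (by linarith [hψ x, hφ y])

lemma exists_continuousMap_extension_dist_le {X Y : Type*} [TopologicalSpace X] [CompactSpace X]
    [T2Space X] [TopologicalSpace Y] [CompactSpace Y] (f : C(X, ℝ)) {e : Y → X}
    (he : Continuous e) (hinj : Injective e) (g : C(Y, ℝ)) {ε : ℝ} (hε : 0 ≤ ε)
    (hg : ∀ y, dist (g y) (f (e y)) ≤ ε) :
    ∃ F : C(X, ℝ), dist F f ≤ ε ∧ ∀ y, F (e y) = g y := by
  obtain ⟨D, hD, hDe⟩ := BoundedContinuousFunction.exists_extension_norm_eq_of_isClosedEmbedding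
    (BoundedContinuousFunction.mkOfCompact (g - f.comp ⟨e, he⟩)) (he.isClosedEmbedding hinj)
  refine ⟨f + D.toContinuousMap, ?_, fun y ↦ ?_⟩
  · rw [ContinuousMap.dist_le hε]
    intro x
    have h1 := D.norm_coe_le_norm x
    rw [hD] at h1
    have h2 := h1.trans ((BoundedContinuousFunction.norm_le hε).2 fun y ↦ hg y)
    simpa using h2
  · have := congrFun hDe y
    simp only [comp_apply] at this
    simp [this]

lemma injOn_iterate_of_injOn_image {X : Type*} {T : X → X} {S : Set X} {N : ℕ}
    (h : ∀ i < N, InjOn T (T^[i] '' S)) : ∀ i ≤ N, InjOn T^[i] S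
  | 0, _ => injOn_id S
  | i + 1, hi => by
    rw [iterate_succ']
    exact (h i hi).comp (injOn_iterate_of_injOn_image h i (by omega)) (mapsTo_image _ _)

lemma isOpen_setOf_observes {X : Type*} [TopologicalSpace X] [LocallyCompactSpace X] {T : X → X}
    (hT : Continuous T) (n : ℕ) {U V : Set X} (hU : IsCompact U) (hV : IsCompact V) :
    IsOpen {f : C(X, ℝ) | ∀ x ∈ U, ∀ y ∈ V, ∃ i : ℕ, i ≤ n ∧ f (T^[i] x) ≠ f (T^[i] y)} := by
  refine isOpen_iff_mem_nhds.2 fun f hf ↦ ?_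
  have hopen : IsOpen {q : C(X, ℝ) × X × X |
      ∃ i : ℕ, i ≤ n ∧ q.1 (T^[i] q.2.1) ≠ q.1 (T^[i] q.2.2)} := by
    simp only [ofPred_exists, ofPred_and]
    refine isOpen_iUnion fun i ↦ isOpen_const.inter ?_
    have := hT.iterate i
    exact isOpen_ne_fun (by fun_prop) (by fun_prop)
  filter_upwards [(hU.prod hV).eventually_forall_of_forall_eventually (x₀ := f)
    (P := fun f q ↦ ∃ i : ℕ, i ≤ n ∧ f (T^[i] q.1) ≠ f (T^[i] q.2))
    fun q hq ↦ hopen.mem_nhds (hf q.1 hq.1 q.2 hq.2)] with f' hf' x hx y hy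
  exact hf' (x, y) ⟨hx, hy⟩

lemma iterate_mem_Hm {X : Type*} {T : X → X} {m k : ℕ} {x : X} (hx : x ∈ Hmk T m k) :
    T^[k] x ∈ Hm T m := by
  unfold Hmk at hx
  split_ifs at hx with h
  · simpa [h] using hx
  · exact hx.1

lemma iterate_eq_of_isPeriodicPt_iterate {X : Type*} {T : X → X} {m k : ℕ} {x : X}
    (hx : IsPeriodicPt T m (T^[k] x)) (i : ℕ) :
    T^[if i < k then i else k + (i - k) % m] x = T^[i] x := by
  split_ifs with h
  · rfl
  · rw [add_comm, iterate_add_apply, hx.iterate_mod_apply, ← iterate_add_apply,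
      Nat.sub_add_cancel (not_lt.1 h)]

lemma injOn_iterate_of_isPeriodicPt_iterate {X : Type*} {T : X → X} {m k : ℕ} {V : Set X}
    (hV : ∀ x ∈ V, IsPeriodicPt T m (T^[k] x)) (hinj : ∀ i < k, InjOn T (T^[i] '' V)) {j : ℕ}
    (hj : j ≤ m + k) : InjOn T^[j] V := by
  intro x hx y hy hxy
  refine injOn_iterate_of_injOn_image hinj k le_rfl hx hy ?_
  have hper {z : X} (hz : z ∈ V) : T^[m + k - j] (T^[j] z) = T^[k] z := by
    rw [← iterate_add_apply, Nat.sub_add_cancel hj, iterate_add_apply]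
    exact hV z hz
  rw [← hper hx, ← hper hy, hxy]

/-- If `U ⊆ X` and `V ⊆ H_{m,k}` are compact with `dim U + dim V ≤ n`, the sets
`U, …, TⁿU, V, …, T^{m+k-1}V` pairwise disjoint (`0 ≤ k ≤ m+k ≤ n`), and `T` injective on
`U, …, T^{n-1}U, V, …, T^{k-1}V`, then the set of `f ∈ C(X, ℝ)` observing `T` on `U × V`
in `n` steps is open and dense. -/
theorem stmt18 {X : Type*} [MetricSpace X] [CompactSpace X]
    (T : X → X) (hTcont : Continuous T) (n m k : ℕ)
    (hm : 1 ≤ m) (hmkn : m + k ≤ n)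
    (U V : Set X) (hUc : IsCompact U) (hVc : IsCompact V)
    (hV : V ⊆ Hmk T m k)
    (hdim : ∃ a b : ℕ, a + b ≤ n ∧ CovDimLE U a ∧ CovDimLE V b)
    (hdisUU : ∀ i j : ℕ, i ≤ n → j ≤ n → i ≠ j → Disjoint (T^[i] '' U) (T^[j] '' U))
    (hdisVV : ∀ i j : ℕ, i < m + k → j < m + k → i ≠ j →
      Disjoint (T^[i] '' V) (T^[j] '' V))
    (hdisUV : ∀ i j : ℕ, i ≤ n → j < m + k → Disjoint (T^[i] '' U) (T^[j] '' V))
    (hinjU : ∀ i : ℕ, i < n → Set.InjOn T (T^[i] '' U))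
    (hinjV : ∀ i : ℕ, i < k → Set.InjOn T (T^[i] '' V)) :
    IsOpen {f : C(X, ℝ) | ∀ x ∈ U, ∀ y ∈ V,
        ∃ i : ℕ, i ≤ n ∧ f (T^[i] x) ≠ f (T^[i] y)} ∧
    Dense {f : C(X, ℝ) | ∀ x ∈ U, ∀ y ∈ V,
        ∃ i : ℕ, i ≤ n ∧ f (T^[i] x) ≠ f (T^[i] y)} := by
  refine ⟨isOpen_setOf_observes hTcont n hUc hVc, Metric.dense_iff.2 fun f ε hε ↦ ?_⟩
  have := isCompact_iff_compactSpace.1 hUc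
  have := isCompact_iff_compactSpace.1 hVc
  have hper : ∀ y ∈ V, IsPeriodicPt T m (T^[k] y) := fun y hy ↦ (iterate_mem_Hm (hV hy)).1
  have hTi (i : ℕ) : Continuous T^[i] := hTcont.iterate i
  let e : (Fin (n + 1) × U) ⊕ (Fin (m + k) × V) → X :=
    Sum.elim (fun p ↦ T^[p.1] p.2) fun p ↦ T^[p.1] p.2
  have he : Continuous e := by
    refine continuous_sum_dom.2 ⟨continuous_prod_of_discrete_left.2 fun i ↦ ?_,
      continuous_prod_of_discrete_left.2 fun i ↦ ?_⟩ <;>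
    exact (hTi i).comp continuous_subtype_val
  have hinj : Injective e := by
    rintro (⟨i, x, hx⟩ | ⟨i, x, hx⟩) (⟨j, y, hy⟩ | ⟨j, y, hy⟩) hxy <;>
      simp only [e, Sum.elim_inl, Sum.elim_inr] at hxy
    · have hij : i = j := by
        by_contra hij
        exact (hdisUU i j (by omega) (by omega) (Fin.val_ne_of_ne hij)).ne_of_mem
          (mem_image_of_mem _ hx) (mem_image_of_mem _ hy) hxy
      subst hij
      have := injOn_iterate_of_injOn_image hinjU i (by omega) hx hy hxy
      subst this
      rfl
    · exact absurd hxy ((hdisUV i j (by omega) (by omega)).ne_of_mem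
        (mem_image_of_mem _ hx) (mem_image_of_mem _ hy))
    · exact absurd hxy.symm ((hdisUV j i (by omega) (by omega)).ne_of_mem
        (mem_image_of_mem _ hy) (mem_image_of_mem _ hx))
    · have hij : i = j := by
        by_contra hij
        exact (hdisVV i j (by omega) (by omega) (Fin.val_ne_of_ne hij)).ne_of_mem
          (mem_image_of_mem _ hx) (mem_image_of_mem _ hy) hxy
      subst hij
      have := injOn_iterate_of_isPeriodicPt_iterate hper hinjV i.2.le hx hy hxy
      subst this
      rfl
  obtain ⟨a, b, hab, ha, hb⟩ := hdim
  let σ (i : Fin (n + 1)) : Fin (m + k) :=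
    ⟨if (i : ℕ) < k then i else k + (i - k) % m, by
      have := Nat.mod_lt (i - k) hm
      split_ifs <;> omega⟩
  let g : C(U, Fin (n + 1) → ℝ) := ⟨fun x i ↦ f (T^[i] x), by fun_prop⟩
  let h : C(V, Fin (m + k) → ℝ) := ⟨fun y j ↦ f (T^[j] y), by fun_prop⟩
  obtain ⟨g', h', hg, hh, hne⟩ := exists_approx_forall_ne ha hb (by simp; omega) g h
    (LinearMap.funLeft ℝ ℝ σ) (half_pos hε)
  let G : C((Fin (n + 1) × U) ⊕ (Fin (m + k) × V), ℝ) :=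
    ⟨Sum.elim (fun p ↦ g' p.2 p.1) fun p ↦ h' p.2 p.1, by
      refine continuous_sum_dom.2 ⟨continuous_prod_of_discrete_left.2 fun i ↦ ?_,
        continuous_prod_of_discrete_left.2 fun i ↦ ?_⟩ <;>
      simp only [comp_apply, Sum.elim_inl, Sum.elim_inr] <;> fun_prop⟩
  obtain ⟨F, hF, hFe⟩ := exists_continuousMap_extension_dist_le f he hinj G (half_pos hε).le (by
    rintro (⟨i, x⟩ | ⟨j, y⟩)
    · exact (dist_le_pi_dist (g' x) (g x) i).trans (hg x)
    · exact (dist_le_pi_dist (h' y) (h y) j).trans (hh y))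
  refine ⟨F, by rw [Metric.mem_ball]; linarith, fun x hx y hy ↦ ?_⟩
  by_contra! hobs
  refine hne ⟨x, hx⟩ ⟨y, hy⟩ (funext fun i ↦ ?_)
  have hgx : F (T^[i] x) = g' ⟨x, hx⟩ i := hFe (Sum.inl (i, ⟨x, hx⟩))
  have hhy : F (T^[σ i] y) = h' ⟨y, hy⟩ (σ i) := hFe (Sum.inr (σ i, ⟨y, hy⟩))
  rw [LinearMap.funLeft_apply, ← hgx, ← hhy, hobs i (by omega)]
  exact congrArg F (iterate_eq_of_isPeriodicPt_iterate (hper y hy) i).symm
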